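/- (Boundary term estimate, inequality (id3) in Proposition 2.3) Let f : ℝ² → ℝⁿ be smooth, 2π-periodic in θ, and satisfy |∂_t f(t,θ)| = |∂_θ f(t,θ)| at every point. Let f*(t) = (1/2π)∫₀^{2π} f(t,θ) dθ. Then for every t ∈ ℝ, |∫₀^{2π} ∂_t f(t,θ) · (f(t,θ) − f*(t)) dθ| ≤ (1/2) ∫₀^{2π} (|∂_t f(t,θ)|² + |∂_θ f(t,θ)|²) dθ. -/

import Mathlib

open MeasureTheory Set Filter
open scoped ENNReal Real RealInnerProductSpace

/-- Partial derivative in the first coordinate direction. -/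
noncomputable def pd1 {n : ℕ} (f : ℝ × ℝ → EuclideanSpace ℝ (Fin n)) (z : ℝ × ℝ) :
    EuclideanSpace ℝ (Fin n) := fderiv ℝ f z (1, 0)

/-- Partial derivative in the second coordinate direction. -/
noncomputable def pd2 {n : ℕ} (f : ℝ × ℝ → EuclideanSpace ℝ (Fin n)) (z : ℝ × ℝ) :
    EuclideanSpace ℝ (Fin n) := fderiv ℝ f z (0, 1)

/-- `|∇f|²`. -/
noncomputable def gradSq {n : ℕ} (f : ℝ × ℝ → EuclideanSpace ℝ (Fin n)) (z : ℝ × ℝ) : ℝ :=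
    ‖pd1 f z‖ ^ 2 + ‖pd2 f z‖ ^ 2

/-- The Laplacian `Δf = ∂²f/∂x² + ∂²f/∂y²`. -/
noncomputable def lap {n : ℕ} (f : ℝ × ℝ → EuclideanSpace ℝ (Fin n)) (z : ℝ × ℝ) :
    EuclideanSpace ℝ (Fin n) := pd1 (pd1 f) z + pd2 (pd2 f) z

/-- The Willmore energy `W(f, Ω) = ∫_{Ω ∩ {∇f ≠ 0}} |Δf|²/|∇f|²`. -/
noncomputable def willmore {n : ℕ} (f : ℝ × ℝ → EuclideanSpace ℝ (Fin n))
    (Ω : Set (ℝ × ℝ)) : ℝ≥0∞ :=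
  ∫⁻ z in Ω ∩ {w | gradSq f w ≠ 0}, ENNReal.ofReal (‖lap f z‖ ^ 2 / gradSq f z)

/-- The circle average `f*(t) = (1/2π) ∫₀^{2π} f(t,θ) dθ`. -/
noncomputable def circAvg {n : ℕ} (f : ℝ × ℝ → EuclideanSpace ℝ (Fin n)) (t : ℝ) :
    EuclideanSpace ℝ (Fin n) := (2 * π)⁻¹ • ∫ θ in (0:ℝ)..(2 * π), f (t, θ)

/-- **Wirtinger's inequality** for complex-valued functions of mean zero on `[a, b]`
with equal values at the endpoints. -/
theorem integral_norm_sq_le_of_hasDerivAt_of_integral_eq_zero {a b : ℝ} (hab : a < b)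
    {g g' : ℝ → ℂ} (hg : ∀ x, HasDerivAt g (g' x) x) (hg' : Continuous g') (hend : g b = g a)
    (hmean : ∫ x in a..b, g x = 0) :
    ∫ x in a..b, ‖g x‖ ^ 2 ≤ ((b - a) / (2 * π)) ^ 2 * ∫ x in a..b, ‖g' x‖ ^ 2 := by
  have hgc : Continuous g := continuous_iff_continuousAt.2 fun x => (hg x).continuousAt
  have memLp_two {u : ℝ → ℂ} (hu : Continuous u) : MemLp u 2 (volume.restrict (Ioc a b)) :=
    (memLp_two_iff_integrable_sq_norm hu.aestronglyMeasurable).2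
      ((intervalIntegrable_iff_integrableOn_Ioc_of_le hab.le).1
        (Continuous.intervalIntegrable (by fun_prop) _ _))
  have hpos : 0 < b - a := sub_pos.2 hab
  have hcoeff (i : ℤ) : ‖fourierCoeffOn hab g i‖ ^ 2 ≤
      ((b - a) / (2 * π)) ^ 2 * ‖fourierCoeffOn hab g' i‖ ^ 2 := by
    rcases eq_or_ne i 0 with rfl | hi
    · have : fourierCoeffOn hab g 0 = 0 := by
        simp [fourierCoeffOn_eq_integral, hmean]
      rw [this, norm_zero, zero_pow two_ne_zero]
      positivity
    · have h1 : (1 : ℝ) ≤ |(i : ℝ)| := by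
        exact_mod_cast Int.one_le_abs hi
      have hle : ‖fourierCoeffOn hab g i‖ ≤ (b - a) / (2 * π) * ‖fourierCoeffOn hab g' i‖ := by
        rw [fourierCoeffOn_of_hasDerivAt hab hi (fun x _ => hg x)
          (hg'.intervalIntegrable _ _), hend, sub_self, mul_zero, zero_sub, ← Complex.ofReal_sub]
        simp only [norm_mul, norm_neg, norm_div, Complex.norm_real, Complex.norm_I,
          Complex.norm_intCast, norm_one, Complex.norm_ofNat, Real.norm_eq_abs, abs_of_pos hpos,
          abs_of_pos Real.pi_pos, mul_one]
        rw [← mul_assoc, one_div_mul_eq_div]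
        exact mul_le_mul_of_nonneg_right (div_le_div_of_nonneg_left hpos.le Real.two_pi_pos
          (le_mul_of_one_le_right Real.two_pi_pos.le h1)) (norm_nonneg _)
      calc _ ≤ ((b - a) / (2 * π) * ‖fourierCoeffOn hab g' i‖) ^ 2 := by gcongr
        _ = _ := mul_pow _ _ _
  have h := hasSum_le hcoeff (hasSum_sq_fourierCoeffOn hab (memLp_two hgc))
    ((hasSum_sq_fourierCoeffOn hab (memLp_two hg')).mul_left _)
  rw [smul_eq_mul, smul_eq_mul, mul_left_comm] at h
  exact le_of_mul_le_mul_left h (inv_pos.2 hpos)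

/-- **Wirtinger's inequality** for functions of mean zero on `[a, b]` with values in a Euclidean
space and equal values at the endpoints. -/
theorem EuclideanSpace.integral_norm_sq_le_of_hasDerivAt_of_integral_eq_zero {ι : Type*}
    [Fintype ι] {a b : ℝ} (hab : a < b) {g g' : ℝ → EuclideanSpace ℝ ι}
    (hg : ∀ x, HasDerivAt g (g' x) x) (hg' : Continuous g') (hend : g b = g a)
    (hmean : ∫ x in a..b, g x = 0) :
    ∫ x in a..b, ‖g x‖ ^ 2 ≤ ((b - a) / (2 * π)) ^ 2 * ∫ x in a..b, ‖g' x‖ ^ 2 := by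
  have hgc : Continuous g := continuous_iff_continuousAt.2 fun x => (hg x).continuousAt
  simp only [EuclideanSpace.norm_sq_eq]
  rw [intervalIntegral.integral_finsetSum fun i _ =>
      (Continuous.intervalIntegrable (by fun_prop) _ _),
    intervalIntegral.integral_finsetSum fun i _ =>
      (Continuous.intervalIntegrable (by fun_prop) _ _), Finset.mul_sum]
  refine Finset.sum_le_sum fun i _ => ?_
  have hmean_i : ∫ x in a..b, g x i = 0 := by
    have := (EuclideanSpace.proj (𝕜 := ℝ) i).intervalIntegral_comp_comm
      (hgc.intervalIntegrable (μ := volume) a b)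
    simpa [hmean] using this
  have h := _root_.integral_norm_sq_le_of_hasDerivAt_of_integral_eq_zero hab
    (g := fun x => (g x i : ℂ)) (g' := fun x => (g' x i : ℂ))
    (fun x => (((EuclideanSpace.proj (𝕜 := ℝ) i).hasFDerivAt.comp_hasDerivAt x
      (hg x))).ofReal_comp) (by fun_prop) (by rw [hend])
    (by rw [intervalIntegral.integral_ofReal, hmean_i, Complex.ofReal_zero])
  simpa only [Complex.norm_real] using h

/-- The integral of an inner product is at most half the sum of the squared `L²` norms. -/
theorem abs_integral_inner_le_half_integral_norm_sq_add {E : Type*} [NormedAddCommGroup E]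
    [InnerProductSpace ℝ E] {a b : ℝ} (hab : a ≤ b) {u v : ℝ → E} (hu : Continuous u)
    (hv : Continuous v) :
    |∫ x in a..b, ⟪u x, v x⟫| ≤
      (1 / 2) * ((∫ x in a..b, ‖u x‖ ^ 2) + ∫ x in a..b, ‖v x‖ ^ 2) := by
  rw [← intervalIntegral.integral_add (Continuous.intervalIntegrable (by fun_prop) _ _)
    (Continuous.intervalIntegrable (by fun_prop) _ _), ← intervalIntegral.integral_const_mul]
  refine (intervalIntegral.abs_integral_le_integral_abs hab).trans
    (intervalIntegral.integral_mono hab (Continuous.intervalIntegrable (by fun_prop) _ _)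
      (Continuous.intervalIntegrable (by fun_prop) _ _) fun x => ?_)
  have := abs_real_inner_le_norm (u x) (v x)
  have := two_mul_le_add_sq ‖u x‖ ‖v x‖
  dsimp only
  linarith

/-- Boundary term estimate (inequality (id3) in Proposition 2.3). -/
theorem boundary_term_estimate (n : ℕ)
    (f : ℝ × ℝ → EuclideanSpace ℝ (Fin n))
    (hsm : ContDiff ℝ (⊤ : ℕ∞) f)
    (hper : ∀ t θ : ℝ, f (t, θ + 2 * π) = f (t, θ))
    (hconf : ∀ z, ‖pd1 f z‖ = ‖pd2 f z‖) :
    ∀ t : ℝ,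
      |∫ θ in (0:ℝ)..(2 * π), ⟪pd1 f (t, θ), f (t, θ) - circAvg f t⟫| ≤
        (1/2) * ∫ θ in (0:ℝ)..(2 * π), (‖pd1 f (t, θ)‖ ^ 2 + ‖pd2 f (t, θ)‖ ^ 2) := by
  intro t
  have h2π : (0 : ℝ) < 2 * π := Real.two_pi_pos
  have hfc : Continuous f := hsm.continuous
  have hfd : Continuous (fderiv ℝ f) := hsm.continuous_fderiv (by simp)
  have hpd1 : Continuous fun θ : ℝ => pd1 f (t, θ) := by unfold pd1; fun_prop
  have hpd2 : Continuous fun θ : ℝ => pd2 f (t, θ) := by unfold pd2; fun_prop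
  have hderiv (θ : ℝ) : HasDerivAt (fun θ => f (t, θ) - circAvg f t) (pd2 f (t, θ)) θ :=
    ((hsm.differentiable (by simp) (t, θ)).hasFDerivAt.comp_hasDerivAt θ
      ((hasDerivAt_const θ t).prodMk (hasDerivAt_id θ))).sub_const _
  have hmean : ∫ θ in (0 : ℝ)..(2 * π), (f (t, θ) - circAvg f t) = 0 := by
    rw [intervalIntegral.integral_sub (Continuous.intervalIntegrable (by fun_prop) _ _)
      intervalIntegrable_const, intervalIntegral.integral_const, sub_zero, circAvg,
      smul_inv_smul₀ h2π.ne', sub_self]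
  have hW := EuclideanSpace.integral_norm_sq_le_of_hasDerivAt_of_integral_eq_zero h2π hderiv hpd2
    (by simpa using hper t 0) hmean
  rw [sub_zero, div_self h2π.ne', one_pow, one_mul] at hW
  refine (abs_integral_inner_le_half_integral_norm_sq_add h2π.le hpd1 (by fun_prop)).trans ?_
  rw [intervalIntegral.integral_add (Continuous.intervalIntegrable (by fun_prop) _ _)
    (Continuous.intervalIntegrable (by fun_prop) _ _)]
  gcongr
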